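/- arXiv:1604.07718 — 2 statements merged into one kernel-verified Lean document; each statement's English description precedes it below -/
import Mathlib

section
/- Fix b > 0 and m, ρ ∈ ℝ, and define H(y) := (r/(r+q))·(Zbar(y) + m/q) for y ∈ ℝ, C := (H(b) + ρ)/Zqr(b), and v_b(x) := C·Zqr(b−x) − H(b−x) for x ∈ ℝ. Then v_b is continuously differentiable on ℝ with v_b′(x) = (r/(r+q))·Zq(b−x) − C·(q/(r+q))·φ·J(b−x) for every x; in particular v_b′(b−) = v_b′(b+) = r/(r+q) − (q/(r+q))·φ·C, so v_b is C¹ across the barrier b for every choice of b. -/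
open MeasureTheory Real Set Filter Topology

/-- `Wbar x = ∫_0^x W(z) dz`. -/
noncomputable def Wbar (W : ℝ → ℝ) (x : ℝ) : ℝ := ∫ z in (0:ℝ)..x, W z

/-- `Zq x = 1 + q · Wbar x`. -/
noncomputable def Zq (q : ℝ) (W : ℝ → ℝ) (x : ℝ) : ℝ := 1 + q * Wbar W x

/-- `Zbar x = ∫_0^x Zq(z) dz`. -/
noncomputable def Zbar (q : ℝ) (W : ℝ → ℝ) (x : ℝ) : ℝ := ∫ z in (0:ℝ)..x, Zq q W z

/-- `J x = e^{φx} (1 − r ∫_0^x e^{−φz} W(z) dz)`. -/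
noncomputable def Jfun (r φ : ℝ) (W : ℝ → ℝ) (x : ℝ) : ℝ :=
  Real.exp (φ * x) * (1 - r * ∫ z in (0:ℝ)..x, Real.exp (-φ * z) * W z)

/-- `Zqr x = (r/(r+q)) Zq x + (q/(r+q)) J x`. -/
noncomputable def Zqr (q r φ : ℝ) (W : ℝ → ℝ) (x : ℝ) : ℝ :=
  (r / (r + q)) * Zq q W x + (q / (r + q)) * Jfun r φ W x

theorem integrable_exp_neg_mul_of_integrableOn_Ioi {φ : ℝ} {W : ℝ → ℝ}
    (hWneg : ∀ x < (0:ℝ), W x = 0)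
    (hWint : IntegrableOn (fun z => Real.exp (-φ * z) * W z) (Set.Ioi 0)) :
    Integrable (fun z => Real.exp (-φ * z) * W z) := by
  have hIio : IntegrableOn (fun z => Real.exp (-φ * z) * W z) (Set.Iio 0) :=
    integrableOn_zero.congr_fun (fun z hz => by simp [hWneg z hz]) measurableSet_Iio
  have hIic : IntegrableOn (fun z => Real.exp (-φ * z) * W z) (Set.Iic 0) :=
    hIio.congr_set_ae Iio_ae_eq_Iic.symm
  rw [← integrableOn_univ, ← Set.Iic_union_Ioi (a := (0:ℝ))]
  exact hIic.union hWint

theorem eq_exp_mul_exp_neg_mul (φ : ℝ) (W : ℝ → ℝ) :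
    W = fun z => Real.exp (φ * z) * (Real.exp (-φ * z) * W z) := by
  funext z
  rw [← mul_assoc, ← Real.exp_add]
  simp

theorem intervalIntegrable_of_integrable_exp_neg_mul {φ : ℝ} {W : ℝ → ℝ}
    (h : Integrable (fun z => Real.exp (-φ * z) * W z)) (a b : ℝ) :
    IntervalIntegrable W volume a b := by
  rw [eq_exp_mul_exp_neg_mul φ W]
  exact h.intervalIntegrable.continuousOn_mul (by fun_prop)

theorem aestronglyMeasurable_of_integrable_exp_neg_mul {φ : ℝ} {W : ℝ → ℝ}
    (h : Integrable (fun z => Real.exp (-φ * z) * W z)) : AEStronglyMeasurable W := by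
  rw [eq_exp_mul_exp_neg_mul φ W]
  exact (by fun_prop : Continuous fun z => Real.exp (φ * z)).aestronglyMeasurable.mul
    h.aestronglyMeasurable

theorem continuousAt_of_ne_zero {W : ℝ → ℝ} (hWneg : ∀ x < (0:ℝ), W x = 0)
    (hWcont : ContinuousOn W (Set.Ioi 0)) {y : ℝ} (hy : y ≠ 0) : ContinuousAt W y := by
  rcases lt_or_gt_of_ne hy with h | h
  · have hev : W =ᶠ[𝓝 y] fun _ => 0 := by
      filter_upwards [Iio_mem_nhds h] with z hz using hWneg z hz
    exact continuousAt_const.congr hev.symm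
  · exact hWcont.continuousAt (Ioi_mem_nhds h)

theorem continuous_Zq {q φ : ℝ} {W : ℝ → ℝ}
    (h : Integrable (fun z => Real.exp (-φ * z) * W z)) : Continuous (Zq q W) :=
  continuous_const.add (continuous_const.mul (intervalIntegral.continuous_primitive
    (intervalIntegrable_of_integrable_exp_neg_mul h) 0))

theorem continuous_Jfun {r φ : ℝ} {W : ℝ → ℝ}
    (h : Integrable (fun z => Real.exp (-φ * z) * W z)) : Continuous (Jfun r φ W) :=
  (by fun_prop : Continuous fun x => Real.exp (φ * x)).mul
    (continuous_const.sub (continuous_const.mul (intervalIntegral.continuous_primitive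
      (fun _ _ => h.intervalIntegrable) 0)))

theorem hasDerivAt_Zbar {q φ : ℝ} {W : ℝ → ℝ}
    (h : Integrable (fun z => Real.exp (-φ * z) * W z)) (x : ℝ) :
    HasDerivAt (Zbar q W) (Zq q W x) x :=
  (continuous_Zq h).integral_hasStrictDerivAt 0 x |>.hasDerivAt

/-- The jump of `W` at `0` cancels in `Zqr`, which is therefore differentiable everywhere. -/
theorem hasDerivAt_Zqr {q r φ : ℝ} {W : ℝ → ℝ} (hWneg : ∀ x < (0:ℝ), W x = 0)
    (hWcont : ContinuousOn W (Set.Ioi 0))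
    (h : Integrable (fun z => Real.exp (-φ * z) * W z)) (x : ℝ) :
    HasDerivAt (Zqr q r φ W) (q / (r + q) * φ * Jfun r φ W x) x := by
  have hne : ∀ y ≠ (0:ℝ), HasDerivAt (Zqr q r φ W) (q / (r + q) * φ * Jfun r φ W y) y := by
    intro y hy
    have hcont := continuousAt_of_ne_zero hWneg hWcont hy
    have hWbar : HasDerivAt (Wbar W) (W y) y :=
      intervalIntegral.integral_hasDerivAt_right
        (intervalIntegrable_of_integrable_exp_neg_mul h 0 y)
        (aestronglyMeasurable_of_integrable_exp_neg_mul h).stronglyMeasurableAtFilter hcont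
    have hL : HasDerivAt (fun u => ∫ z in (0:ℝ)..u, Real.exp (-φ * z) * W z)
        (Real.exp (-φ * y) * W y) y :=
      intervalIntegral.integral_hasDerivAt_right h.intervalIntegrable
        h.aestronglyMeasurable.stronglyMeasurableAtFilter
        ((by fun_prop : ContinuousAt (fun z => Real.exp (-φ * z)) y).mul hcont)
    have hexp : HasDerivAt (fun u => Real.exp (φ * u)) (Real.exp (φ * y) * (φ * 1)) y :=
      ((hasDerivAt_id y).const_mul φ).exp
    have hJ := hexp.mul ((hL.const_mul r).const_sub 1)
    have hZ := (hWbar.const_mul q).const_add 1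
    refine ((hZ.const_mul (r / (r + q))).add (hJ.const_mul (q / (r + q)))).congr_deriv ?_
    have hcancel : Real.exp (φ * y) * Real.exp (-φ * y) = 1 := by
      rw [← Real.exp_add]
      simp
    simp only [Jfun]
    linear_combination (-(q / (r + q)) * r * W y) * hcancel
  rcases eq_or_ne x 0 with rfl | hx
  · exact hasDerivAt_of_hasDerivAt_of_ne hne
      ((continuous_const.mul (continuous_Zq h)).add
        (continuous_const.mul (continuous_Jfun h))).continuousAt
      (continuous_const.mul (continuous_Jfun h)).continuousAt
  · exact hne x hx

/-- with H(y) = (r/(r+q))(Zbar(y)+m/q), C = (H(b)+ρ)/Zqr(b) and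
v_b(x) = C·Zqr(b−x) − H(b−x), the function v_b is continuously differentiable on ℝ with
v_b′(x) = (r/(r+q))·Zq(b−x) − C·(q/(r+q))·φ·J(b−x); in particular
v_b′(b) = r/(r+q) − (q/(r+q))·φ·C, so v_b is C¹ across the barrier b. -/
theorem vb_C1
    (q r φ : ℝ) (W : ℝ → ℝ)
    (hq : 0 < q) (hr : 0 < r) (hφ : 0 < φ)
    (hWneg : ∀ x < (0:ℝ), W x = 0)
    (hWnn : ∀ x : ℝ, 0 ≤ W x)
    (hWcont : ContinuousOn W (Set.Ioi 0))
    (hWmono : StrictMonoOn W (Set.Ioi 0))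
    (W0 : ℝ)
    (hW0 : Filter.Tendsto W (nhdsWithin 0 (Set.Ioi 0)) (nhds W0))
    (hWint : MeasureTheory.IntegrableOn (fun z => Real.exp (-φ * z) * W z) (Set.Ioi 0))
    (hWlap : r * ∫ z in Set.Ioi (0:ℝ), Real.exp (-φ * z) * W z = 1)
    (b : ℝ) (hb : 0 < b) (m ρ : ℝ)
    (H : ℝ → ℝ) (hH : ∀ y : ℝ, H y = r / (r + q) * (Zbar q W y + m / q))
    (C : ℝ) (hC : C = (H b + ρ) / Zqr q r φ W b)
    (vb : ℝ → ℝ) (hvb : ∀ x : ℝ, vb x = C * Zqr q r φ W (b - x) - H (b - x))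
    (D : ℝ → ℝ)
    (hD : ∀ x : ℝ, D x = r / (r + q) * Zq q W (b - x) - C * (q / (r + q)) * φ * Jfun r φ W (b - x))
    : (∀ x : ℝ, HasDerivAt vb (D x) x) ∧ Continuous D ∧
      D b = r / (r + q) - q / (r + q) * φ * C := by
  have h := integrable_exp_neg_mul_of_integrableOn_Ioi hWneg hWint
  obtain rfl : D = _ := funext hD
  obtain rfl : vb = _ := funext hvb
  obtain rfl : H = _ := funext hH
  refine ⟨fun x => ?_, ?_, ?_⟩
  · have hsub : HasDerivAt (fun x => b - x) (-1) x := (hasDerivAt_id x).const_sub b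
    have hZqr := (hasDerivAt_Zqr (q := q) (r := r) hWneg hWcont h (b - x)).comp x hsub
    have hZbar := (hasDerivAt_Zbar (q := q) h (b - x)).comp x hsub
    refine ((hZqr.const_mul C).sub
      ((hZbar.add_const (m / q)).const_mul (r / (r + q)))).congr_deriv ?_
    ring
  · have hsub : Continuous fun x => b - x := by fun_prop
    exact (continuous_const.mul ((continuous_Zq h).comp hsub)).sub
      (continuous_const.mul ((continuous_Jfun h).comp hsub))
  · simp only [sub_self, Zq, Wbar, Jfun, intervalIntegral.integral_same, mul_zero, Real.exp_zero]
    ring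
end

section
/- Fix b > 0 and define v(x) := −(r/(r+q))·(Zbar(b−x) + m/q) − Zqr(b−x)/φ for x ∈ ℝ. Then for every x ∈ (0, b), the integral in (ℒv)(x) converges absolutely and (ℒ − q)v(x) = 0; and for every x > b, (ℒ − q)v(x) = (q·r/(r+q))·[ (b−x) + (1 − e^{φ(b−x)})/φ ]. -/
open MeasureTheory Real Set Filter Topology

/-- The Laplace exponent ψ(θ) = γθ + (σ²/2)θ² + ∫_{(0,∞)} (e^{−θz} − 1 + θz·1_{0<z<1}) ν(dz)
of a spectrally positive Lévy process. -/
noncomputable def levyPsi (γ σ : ℝ) (ν : MeasureTheory.Measure ℝ) (θ : ℝ) : ℝ :=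
  γ * θ + σ ^ 2 / 2 * θ ^ 2 +
    ∫ z in Set.Ioi (0:ℝ),
      (Real.exp (-θ * z) - 1 + θ * Set.indicator (Set.Ioo (0:ℝ) 1) id z) ∂ν

/-- The generator (ℒg)(x) = −γg′(x) + (σ²/2)g″(x)
+ ∫_{(0,∞)} (g(x+z) − g(x) − g′(x)·z·1_{0<z<1}) ν(dz). -/
noncomputable def levyGen (γ σ : ℝ) (ν : MeasureTheory.Measure ℝ) (g : ℝ → ℝ) (x : ℝ) : ℝ :=
  -γ * deriv g x + σ ^ 2 / 2 * deriv (deriv g) x +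
    ∫ z in Set.Ioi (0:ℝ),
      (g (x + z) - g x - deriv g x * Set.indicator (Set.Ioo (0:ℝ) 1) id z) ∂ν

/-- A continuous function on `(0,∞)` whose Laplace transform vanishes on a half-line is zero. -/
theorem eqOn_zero_of_laplace_eq_zero {g : ℝ → ℝ} {a : ℝ} (hg : ContinuousOn g (Ioi 0))
    (hint : ∀ θ > a, IntegrableOn (fun y => exp (-θ * y) * g y) (Ioi 0))
    (hzero : ∀ θ > a, ∫ y in Ioi (0:ℝ), exp (-θ * y) * g y = 0) :
    EqOn g 0 (Ioi 0) := by
  set G : ℝ → ℝ := fun y => exp (-(a + 1) * y) * g y with hG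
  have hGc : ContinuousOn G (Ioi 0) := by
    apply ContinuousOn.mul _ hg
    fun_prop
  have hGint : IntegrableOn G (Ioi 0) := hint (a + 1) (by linarith)
  have hmono : ∀ (n : ℕ) (c y : ℝ),
      G y * (Polynomial.monomial n c).eval (exp (-y)) =
        c * (exp (-(a + 1 + n) * y) * g y) := by
    intro n c y
    rw [Polynomial.eval_monomial, ← Real.exp_nat_mul, hG]
    have : exp (-(a + 1 + n) * y) = exp (-(a + 1) * y) * exp (n * -y) := by
      rw [← Real.exp_add]; ring_nf
    rw [this]; ring
  have hpoly : ∀ p : Polynomial ℝ, IntegrableOn (fun y => G y * p.eval (exp (-y))) (Ioi 0) ∧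
      ∫ y in Ioi (0:ℝ), G y * p.eval (exp (-y)) = 0 := by
    intro p
    induction p using Polynomial.induction_on' with
    | add p s hp hs =>
      simp only [Polynomial.eval_add, mul_add]
      exact ⟨hp.1.add hs.1, by rw [integral_add hp.1 hs.1, hp.2, hs.2, add_zero]⟩
    | monomial n c =>
      have hn : a + 1 + n > a := by linarith [(Nat.cast_nonneg n : (0:ℝ) ≤ n)]
      simp only [hmono]
      exact ⟨(hint _ hn).const_mul c, by rw [integral_const_mul, hzero _ hn, mul_zero]⟩
  have hmaps : ∀ y ∈ Ioi (0:ℝ), exp (-y) ∈ Icc (0:ℝ) 1 := fun y hy =>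
    ⟨(exp_pos _).le, exp_le_one_iff.2 (by simpa using le_of_lt hy)⟩
  have hcont : ∀ h : ℝ → ℝ, Continuous h →
      IntegrableOn (fun y => G y * h (exp (-y))) (Ioi 0) ∧
      ∫ y in Ioi (0:ℝ), G y * h (exp (-y)) = 0 := by
    intro h hh
    obtain ⟨B, hB⟩ := isCompact_Icc.exists_bound_of_continuousOn (hh.continuousOn (s := Icc 0 1))
    have hhint : IntegrableOn (fun y => G y * h (exp (-y))) (Ioi 0) := by
      refine Integrable.mul_bdd (c := B) hGint
        (by fun_prop : Continuous fun y => h (exp (-y))).aestronglyMeasurable ?_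
      exact (ae_restrict_iff' measurableSet_Ioi).2 (ae_of_all _ fun y hy => hB _ (hmaps y hy))
    refine ⟨hhint, ?_⟩
    by_contra hne
    have hpos := abs_pos.2 hne
    set A := ∫ y in Ioi (0:ℝ), |G y|
    have hA : 0 ≤ A := integral_nonneg fun _ => abs_nonneg _
    set ε := |∫ y in Ioi (0:ℝ), G y * h (exp (-y))| / (A + 1)
    obtain ⟨p, hp⟩ := exists_polynomial_near_of_continuousOn 0 1 h hh.continuousOn ε (by positivity)
    have h1 : |∫ y in Ioi (0:ℝ), G y * h (exp (-y))| ≤ A * ε := by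
      have : ∫ y in Ioi (0:ℝ), G y * h (exp (-y)) =
          ∫ y in Ioi (0:ℝ), (G y * h (exp (-y)) - G y * p.eval (exp (-y))) := by
        rw [integral_sub hhint (hpoly p).1, (hpoly p).2, sub_zero]
      rw [this, ← integral_mul_const, ← Real.norm_eq_abs]
      refine norm_integral_le_of_norm_le (hGint.abs.mul_const ε) ?_
      refine (ae_restrict_iff' measurableSet_Ioi).2 (ae_of_all _ fun y hy => ?_)
      rw [← mul_sub, norm_mul, Real.norm_eq_abs, Real.norm_eq_abs, abs_sub_comm]
      exact mul_le_mul_of_nonneg_left (hp _ (hmaps y hy)).le (abs_nonneg _)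
    have h2 : (A + 1) * ε = |∫ y in Ioi (0:ℝ), G y * h (exp (-y))| :=
      mul_div_cancel₀ _ (by positivity)
    have : 0 < ε := by positivity
    linarith
  have key : ∀ s : ℝ, ∀ y₀ ∈ Ioi (0:ℝ), ¬ 0 < s * g y₀ := by
    intro s y₀ hy₀ hpos
    have hc : ContinuousAt (fun t => s * g (-log t)) (exp (-y₀)) := by
      refine continuousAt_const.mul (ContinuousAt.comp (g := g) (f := fun t => -log t) ?_ ?_)
      · simpa using hg.continuousAt (Ioi_mem_nhds hy₀)
      · exact (continuousAt_log (exp_ne_zero _)).neg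
    have hev : ∀ᶠ t in 𝓝 (exp (-y₀)), 0 < s * g (-log t) :=
      hc.eventually (lt_mem_nhds (by simpa using hpos))
    obtain ⟨η, hη, hball⟩ := Metric.eventually_nhds_iff.1 hev
    set h : ℝ → ℝ := fun t => s * max 0 (η - |t - exp (-y₀)|) with hh
    have hhc : Continuous h := by fun_prop
    obtain ⟨hi, hz⟩ := hcont h hhc
    have hnn : ∀ y, 0 ≤ G y * h (exp (-y)) := by
      intro y
      by_cases hy : |exp (-y) - exp (-y₀)| < η
      · have := hball (by simpa [Real.dist_eq] using hy)
        simp only [log_exp, neg_neg] at this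
        have e : G y * h (exp (-y)) = exp (-(a + 1) * y) * (s * g y) *
          max 0 (η - |exp (-y) - exp (-y₀)|) := by simp only [hG, hh]; ring
        rw [e]; positivity
      · have : max 0 (η - |exp (-y) - exp (-y₀)|) = 0 := max_eq_left (by linarith)
        simp [hh, this]
    have hae := (integral_eq_zero_iff_of_nonneg (fun y => hnn y) hi).1 hz
    have heq := Measure.eqOn_open_of_ae_eq hae isOpen_Ioi
      (hGc.mul (by fun_prop : Continuous fun y => h (exp (-y))).continuousOn) continuousOn_const hy₀
    have : G y₀ * h (exp (-y₀)) = exp (-(a + 1) * y₀) * (s * g y₀) * η := by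
      simp only [hG, hh, sub_self, abs_zero, sub_zero, max_eq_right hη.le]; ring
    have hlt : 0 < G y₀ * h (exp (-y₀)) := by rw [this]; positivity
    exact hlt.ne' heq
  intro y hy
  by_contra hne
  exact key (g y) y hy (mul_self_pos.2 hne)

/-- The Laplace transform of a derivative. -/
theorem laplace_deriv {g g' : ℝ → ℝ} {θ : ℝ} (h0 : g 0 = 0) (hc : ContinuousWithinAt g (Ici 0) 0)
    (hd : ∀ y ∈ Ioi (0:ℝ), HasDerivAt g (g' y) y)
    (hg : IntegrableOn (fun y => exp (-θ * y) * g y) (Ioi 0))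
    (hg' : IntegrableOn (fun y => exp (-θ * y) * g' y) (Ioi 0)) :
    ∫ y in Ioi (0:ℝ), exp (-θ * y) * g' y = θ * ∫ y in Ioi (0:ℝ), exp (-θ * y) * g y := by
  have hd' : ∀ y ∈ Ioi (0:ℝ), HasDerivAt (fun y => exp (-θ * y) * g y)
      (exp (-θ * y) * g' y - θ * (exp (-θ * y) * g y)) y := by
    intro y hy
    have h1 : HasDerivAt (fun y => exp (-θ * y)) (exp (-θ * y) * (-θ * 1)) y :=
      ((hasDerivAt_id y).const_mul (-θ)).exp
    exact (h1.mul (hd y hy)).congr_deriv (by ring)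
  have hi := hg'.sub (hg.const_mul θ)
  have ht := tendsto_zero_of_hasDerivAt_of_integrableOn_Ioi hd' hi hg
  have hc' : ContinuousWithinAt (fun y => exp (-θ * y) * g y) (Ici 0) 0 :=
    (by fun_prop : Continuous fun y => exp (-θ * y)).continuousWithinAt.mul hc
  have := integral_Ioi_of_hasDerivAt_of_tendsto hc' hd' hi ht
  rw [integral_sub hg' (hg.const_mul θ), integral_const_mul, h0] at this
  linarith

/-- The compensated increment of a function over a downward jump of size `z`. -/
noncomputable def levyIncr (f f' : ℝ → ℝ) (y z : ℝ) : ℝ :=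
  f (y - z) - f y + f' y * Set.indicator (Set.Ioo (0:ℝ) 1) id z

theorem measurable_levyIncr {f f' : ℝ → ℝ} (hf : Measurable f) (hf' : Measurable f') :
    Measurable (Function.uncurry (levyIncr f f')) := by
  have h : Measurable (Set.indicator (Set.Ioo (0:ℝ) 1) id) :=
    measurable_id.indicator measurableSet_Ioo
  exact ((hf.comp (measurable_fst.sub measurable_snd)).sub (hf.comp measurable_fst)).add
    ((hf'.comp measurable_fst).mul (h.comp measurable_snd))

/-- A nonnegative, nondecreasing and convex `C²` function, together with its second derivative,
of exponential growth. -/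
structure IsExpConvex (C a : ℝ) (f f' f'' : ℝ → ℝ) : Prop where
  hasDerivAt : ∀ y, HasDerivAt f (f' y) y
  hasDerivAt' : ∀ y, HasDerivAt f' (f'' y) y
  nonneg : ∀ y, 0 ≤ f y
  nonneg' : ∀ y, 0 ≤ f' y
  nonneg'' : ∀ y, 0 ≤ f'' y
  le : ∀ y, f y ≤ C * exp (a * y)
  le'' : ∀ y, f'' y ≤ C * exp (a * y)
  rate_nonneg : 0 ≤ a

namespace IsExpConvex

variable {C a : ℝ} {f f' f'' : ℝ → ℝ}

theorem continuous (h : IsExpConvex C a f f' f'') : Continuous f :=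
  continuous_iff_continuousAt.2 fun y => (h.hasDerivAt y).continuousAt

theorem continuous' (h : IsExpConvex C a f f' f'') : Continuous f' :=
  continuous_iff_continuousAt.2 fun y => (h.hasDerivAt' y).continuousAt

theorem abs_levyIncr_le (h : IsExpConvex C a f f' f'') (y : ℝ) {z : ℝ} (hz : 0 < z) :
    |levyIncr f f' y z| ≤ C * exp (a * y) * min 1 (z ^ 2) := by
  have hmono : Monotone f := monotone_of_hasDerivAt_nonneg h.hasDerivAt h.nonneg'
  rcases lt_or_ge z 1 with h1 | h1
  · have hmin : min 1 (z ^ 2) = z ^ 2 := min_eq_right (by nlinarith)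
    have hmono' : Monotone f' := monotone_of_hasDerivAt_nonneg h.hasDerivAt' h.nonneg''
    obtain ⟨c, hc, hc'⟩ := exists_hasDerivAt_eq_slope f f' (by linarith : y - z < y)
      h.continuous.continuousOn fun x _ => h.hasDerivAt x
    obtain ⟨d, hd, hd'⟩ := exists_hasDerivAt_eq_slope f' f'' hc.2
      h.continuous'.continuousOn fun x _ => h.hasDerivAt' x
    have hcy : 0 < y - c := by linarith [hc.2]
    rw [eq_div_iff (by linarith)] at hc' hd'
    have e : levyIncr f f' y z = z * (f'' d * (y - c)) := by
      have hmem : z ∈ Ioo (0:ℝ) 1 := ⟨hz, h1⟩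
      rw [levyIncr, indicator_of_mem hmem, id, hd']
      linarith
    have hb : f'' d ≤ C * exp (a * y) := (h.le'' d).trans <| by
      have h0 : 0 ≤ C * exp (a * y) := (h.nonneg y).trans (h.le y)
      have hC : 0 ≤ C := nonneg_of_mul_nonneg_left h0 (exp_pos _)
      have : a * d ≤ a * y := mul_le_mul_of_nonneg_left hd.2.le h.rate_nonneg
      gcongr
    rw [e, hmin, abs_of_nonneg (mul_nonneg hz.le (mul_nonneg (h.nonneg'' d) hcy.le))]
    calc z * (f'' d * (y - c)) ≤ z * (C * exp (a * y) * z) := by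
          have h0 := (h.nonneg'' d).trans hb
          have : y - c ≤ z := by linarith [hc.1]
          gcongr
      _ = _ := by ring
  · have hmin : min 1 (z ^ 2) = 1 := min_eq_left (by nlinarith)
    have hmem : z ∉ Ioo (0:ℝ) 1 := fun hm => not_lt.2 h1 hm.2
    have h2 := hmono (by linarith : y - z ≤ y)
    rw [levyIncr, indicator_of_notMem hmem, hmin, mul_zero, add_zero, mul_one, abs_sub_comm,
      abs_of_nonneg (by linarith)]
    linarith [h.nonneg (y - z), h.le y]

theorem integrableOn_levyIncr (h : IsExpConvex C a f f' f'') {ν : Measure ℝ}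
    (hν : IntegrableOn (fun z => min 1 (z ^ 2)) (Ioi 0) ν) (y : ℝ) :
    IntegrableOn (levyIncr f f' y) (Ioi 0) ν := by
  refine Integrable.mono' (hν.const_mul (C * exp (a * y)))
    ((measurable_levyIncr h.continuous.measurable h.continuous'.measurable).comp
      measurable_prodMk_left).aestronglyMeasurable ?_
  exact (ae_restrict_iff' measurableSet_Ioi).2 (ae_of_all _ fun z hz => h.abs_levyIncr_le y hz)

theorem continuous_integral_levyIncr (h : IsExpConvex C a f f' f'') {ν : Measure ℝ}
    (hν : IntegrableOn (fun z => min 1 (z ^ 2)) (Ioi 0) ν) :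
    Continuous fun y => ∫ z in Ioi (0:ℝ), levyIncr f f' y z ∂ν := by
  refine continuous_iff_continuousAt.2 fun y₀ => ?_
  refine continuousAt_of_dominated (bound := fun z => C * exp (a * (y₀ + 1)) * min 1 (z ^ 2))
    (Eventually.of_forall fun y => (h.integrableOn_levyIncr hν y).aestronglyMeasurable) ?_
    (hν.const_mul _) (ae_of_all _ fun z => ?_)
  · filter_upwards [Iio_mem_nhds (lt_add_one y₀)] with y hy
    refine (ae_restrict_iff' measurableSet_Ioi).2 (ae_of_all _ fun z hz => ?_)
    refine (h.abs_levyIncr_le y hz).trans ?_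
    have h0 : 0 ≤ C * exp (a * y) := (h.nonneg y).trans (h.le y)
    have hC : 0 ≤ C := nonneg_of_mul_nonneg_left h0 (exp_pos _)
    have : a * y ≤ a * (y₀ + 1) := mul_le_mul_of_nonneg_left (le_of_lt hy) h.rate_nonneg
    gcongr
  · have := h.continuous
    have := h.continuous'
    unfold levyIncr
    fun_prop

end IsExpConvex

theorem sFinite_restrict_of_integrableOn_min {ν : Measure ℝ}
    (hν : IntegrableOn (fun z => min 1 (z ^ 2)) (Ioi 0) ν) : SFinite (ν.restrict (Ioi 0)) := by
  set g : ℝ → ENNReal := fun z => ENNReal.ofReal (min 1 (z ^ 2))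
  have hg : Measurable g := by fun_prop
  have : IsFiniteMeasure ((ν.restrict (Ioi 0)).withDensity g) :=
    isFiniteMeasure_withDensity_ofReal hν.2
  have h0 : ∀ᵐ z ∂ν.restrict (Ioi 0), g z ≠ 0 := by
    refine (ae_restrict_iff' measurableSet_Ioi).2 (ae_of_all _ fun z hz => ?_)
    have hz' : 0 < z := hz
    have : 0 < min 1 (z ^ 2) := by positivity
    simpa [g] using hz'.ne'
  rw [← withDensity_inv_same hg h0 (ae_of_all _ fun z => ENNReal.ofReal_ne_top)]
  infer_instance

/-- The Laplace transform of the jump part of the generator. -/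
theorem IsExpConvex.laplace_integral_levyIncr {C a : ℝ} {f f' f'' : ℝ → ℝ}
    (h : IsExpConvex C a f f' f'') {ν : Measure ℝ}
    (hν : IntegrableOn (fun z => min 1 (z ^ 2)) (Ioi 0) ν) (hf0 : ∀ y ≤ 0, f y = 0) {θ : ℝ}
    (hθ : a < θ) (hf : IntegrableOn (fun y => exp (-θ * y) * f y) (Ioi 0))
    (hf' : IntegrableOn (fun y => exp (-θ * y) * f' y) (Ioi 0)) :
    IntegrableOn (fun y => exp (-θ * y) * ∫ z in Ioi (0:ℝ), levyIncr f f' y z ∂ν) (Ioi 0) ∧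
    ∫ y in Ioi (0:ℝ), exp (-θ * y) * ∫ z in Ioi (0:ℝ), levyIncr f f' y z ∂ν =
      (∫ y in Ioi (0:ℝ), exp (-θ * y) * f y) * ∫ z in Ioi (0:ℝ),
        (exp (-θ * z) - 1 + θ * Set.indicator (Set.Ioo (0:ℝ) 1) id z) ∂ν := by
  have := sFinite_restrict_of_integrableOn_min hν
  have hexp : IntegrableOn (fun y => C * exp (-(θ - a) * y)) (Ioi 0) :=
    (integrableOn_exp_mul_Ioi (by linarith) 0).const_mul C
  have hprod : Integrable (Function.uncurry fun y z => exp (-θ * y) * levyIncr f f' y z)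
      ((volume.restrict (Ioi 0)).prod (ν.restrict (Ioi 0))) := by
    refine Integrable.mono' (hexp.mul_prod hν) (Measurable.aestronglyMeasurable ?_) ?_
    · exact (by fun_prop : Measurable fun p : ℝ × ℝ => exp (-θ * p.1)).mul
        (measurable_levyIncr h.continuous.measurable h.continuous'.measurable)
    · have hpos : ∀ᵐ p ∂(volume.restrict (Ioi (0:ℝ))).prod (ν.restrict (Ioi 0)), 0 < p.2 :=
        Measure.quasiMeasurePreserving_snd.ae (ae_restrict_mem measurableSet_Ioi)
      filter_upwards [hpos] with p hp
      have e : exp (-(θ - a) * p.1) = exp (-θ * p.1) * exp (a * p.1) := by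
        rw [← Real.exp_add]; ring_nf
      rw [Function.uncurry_apply_pair, norm_mul, Real.norm_eq_abs, Real.norm_eq_abs, abs_exp, e]
      calc _ ≤ exp (-θ * p.1) * (C * exp (a * p.1) * min 1 (p.2 ^ 2)) :=
            mul_le_mul_of_nonneg_left (h.abs_levyIncr_le _ hp) (exp_pos _).le
        _ = _ := by ring
  have hinner : ∀ z ∈ Ioi (0:ℝ), ∫ y in Ioi (0:ℝ), exp (-θ * y) * levyIncr f f' y z =
      (∫ y in Ioi (0:ℝ), exp (-θ * y) * f y) *
        (exp (-θ * z) - 1 + θ * Set.indicator (Set.Ioo (0:ℝ) 1) id z) := by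
    intro z hz
    have hz : 0 < z := hz
    have hfull : ∫ y in Ioi (0:ℝ), exp (-θ * y) * f y = ∫ y, exp (-θ * y) * f y :=
      setIntegral_eq_integral_of_forall_compl_eq_zero fun y hy => by
        rw [hf0 y (not_lt.1 hy), mul_zero]
    have hsupp : ∀ y ∉ Ioi (0:ℝ), exp (-θ * y) * f (y - z) = 0 := fun y hy => by
      rw [hf0 (y - z) (by linarith [not_lt.1 (show ¬ 0 < y from hy)]), mul_zero]
    have hshift : ∀ y, exp (-θ * y) * f (y - z) =
        exp (-θ * z) * (exp (-θ * (y - z)) * f (y - z)) := fun y => by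
      rw [← mul_assoc, ← Real.exp_add]; ring_nf
    have hI : ∫ y in Ioi (0:ℝ), exp (-θ * y) * f (y - z) =
        exp (-θ * z) * ∫ y in Ioi (0:ℝ), exp (-θ * y) * f y := by
      rw [setIntegral_eq_integral_of_forall_compl_eq_zero hsupp, hfull]
      simp_rw [hshift]
      rw [integral_const_mul, integral_sub_right_eq_self (fun y => exp (-θ * y) * f y) z]
    have hint : IntegrableOn (fun y => exp (-θ * y) * f (y - z)) (Ioi 0) := by
      have h1 : Integrable fun y => exp (-θ * y) * f y :=
        (integrableOn_iff_integrable_of_support_subset fun y hy => by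
          by_contra hc
          exact hy (by simp only [hf0 y (not_lt.1 hc), mul_zero])).1 hf
      simp_rw [hshift]
      exact ((h1.comp_sub_right z).const_mul _).integrableOn
    have hL : ∫ y in Ioi (0:ℝ), exp (-θ * y) * f' y =
        θ * ∫ y in Ioi (0:ℝ), exp (-θ * y) * f y :=
      laplace_deriv (hf0 0 le_rfl) h.continuous.continuousWithinAt
        (fun y _ => h.hasDerivAt y) hf hf'
    have e : ∀ y, exp (-θ * y) * levyIncr f f' y z = exp (-θ * y) * f (y - z) -
        exp (-θ * y) * f y + exp (-θ * y) * f' y * Set.indicator (Set.Ioo (0:ℝ) 1) id z :=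
      fun y => by rw [levyIncr]; ring
    have hs : IntegrableOn (fun y => exp (-θ * y) * f (y - z) - exp (-θ * y) * f y) (Ioi 0) :=
      hint.sub hf
    simp_rw [e]
    rw [integral_add hs (hf'.mul_const _), integral_sub hint hf, integral_mul_const,
      hI, hL]
    ring
  constructor
  · simp_rw [← integral_const_mul]
    exact hprod.integral_prod_left
  · simp_rw [← integral_const_mul]
    rw [integral_integral_swap hprod]
    exact setIntegral_congr_fun measurableSet_Ioi hinner

theorem integrableOn_laplace_of_abs_le {g : ℝ → ℝ} {C a θ : ℝ} (hg : Continuous g) (hθ : a < θ)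
    (hle : ∀ y > 0, |g y| ≤ C * exp (a * y)) :
    IntegrableOn (fun y => exp (-θ * y) * g y) (Ioi 0) := by
  refine Integrable.mono' (g := fun y => C * exp (-(θ - a) * y))
    ((integrableOn_exp_mul_Ioi (by linarith) 0).const_mul C)
    (by fun_prop : Continuous fun y => exp (-θ * y) * g y).aestronglyMeasurable ?_
  refine (ae_restrict_iff' measurableSet_Ioi).2 (ae_of_all _ fun y hy => ?_)
  have e : exp (-(θ - a) * y) = exp (-θ * y) * exp (a * y) := by
    rw [← Real.exp_add]; ring_nf
  rw [norm_mul, Real.norm_eq_abs, Real.norm_eq_abs, abs_exp, e, mul_left_comm]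
  exact mul_le_mul_of_nonneg_left (hle y hy) (exp_pos _).le

theorem intervalIntegral_eq_zero_of_nonpos {g : ℝ → ℝ} (hg : ∀ x < 0, g x = 0) {y : ℝ}
    (hy : y ≤ 0) : ∫ x in (0:ℝ)..y, g x = 0 := by
  rw [intervalIntegral.integral_symm, intervalIntegral.integral_of_le hy,
    integral_Ioc_eq_integral_Ioo, setIntegral_eq_zero_of_forall_eq_zero fun x hx => hg x hx.2,
    neg_zero]

/-- The convolution `W * exp (φ ·)`. -/
noncomputable def expConv (φ : ℝ) (W : ℝ → ℝ) (y : ℝ) : ℝ :=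
  exp (φ * y) * ∫ z in (0:ℝ)..y, exp (-φ * z) * W z

/-- The convolution `W * (exp (φ ·) - 1)`. -/
noncomputable def expConv₁ (φ : ℝ) (W : ℝ → ℝ) (y : ℝ) : ℝ := φ * ∫ z in (0:ℝ)..y, expConv φ W z

/-- The convolution `W * ((exp (φ ·) - 1 - φ ·) / φ)`. -/
noncomputable def expConv₂ (φ : ℝ) (W : ℝ → ℝ) (y : ℝ) : ℝ := ∫ z in (0:ℝ)..y, expConv₁ φ W z

section expConv

variable {φ : ℝ} {W : ℝ → ℝ}

theorem expConv_of_nonpos (hneg : ∀ x < 0, W x = 0) {y : ℝ} (hy : y ≤ 0) : expConv φ W y = 0 := by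
  rw [expConv, intervalIntegral_eq_zero_of_nonpos (fun x hx => by rw [hneg x hx, mul_zero]) hy,
    mul_zero]

theorem expConv₁_of_nonpos (hneg : ∀ x < 0, W x = 0) {y : ℝ} (hy : y ≤ 0) :
    expConv₁ φ W y = 0 := by
  rw [expConv₁, intervalIntegral_eq_zero_of_nonpos (fun x hx => expConv_of_nonpos hneg hx.le) hy,
    mul_zero]

theorem expConv₂_of_nonpos (hneg : ∀ x < 0, W x = 0) {y : ℝ} (hy : y ≤ 0) :
    expConv₂ φ W y = 0 :=
  intervalIntegral_eq_zero_of_nonpos (fun _ hx => expConv₁_of_nonpos hneg hx.le) hy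

theorem integrable_exp_mul_of_integrableOn (hneg : ∀ x < 0, W x = 0)
    (hint : IntegrableOn (fun z => exp (-φ * z) * W z) (Ioi 0)) :
    Integrable (fun z => exp (-φ * z) * W z) := by
  refine (integrableOn_iff_integrable_of_support_subset (s := Ici 0) fun y hy => ?_).1
    ((integrableOn_Ici_iff_integrableOn_Ioi (by simp)).2 hint)
  by_contra hc
  exact hy (by simp only [hneg y (not_le.1 hc), mul_zero])

theorem intervalIntegrable_of_integrable_exp_mul
    (hint : Integrable (fun z => exp (-φ * z) * W z)) (a b : ℝ) :
    IntervalIntegrable W volume a b := by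
  have h := (hint.intervalIntegrable (a := a) (b := b)).continuousOn_mul
    (by fun_prop : Continuous fun z => exp (φ * z)).continuousOn
  refine h.congr fun z _ => ?_
  rw [← mul_assoc, ← Real.exp_add]
  simp

theorem continuous_expConv (hint : Integrable (fun z => exp (-φ * z) * W z)) :
    Continuous (expConv φ W) :=
  (by fun_prop : Continuous fun y => exp (φ * y)).mul
    (intervalIntegral.continuous_primitive (fun _ _ => hint.intervalIntegrable) 0)

theorem hasDerivAt_expConv (hint : Integrable (fun z => exp (-φ * z) * W z))
    (hcont : ContinuousOn W (Ioi 0)) {y : ℝ} (hy : 0 < y) :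
    HasDerivAt (expConv φ W) (φ * expConv φ W y + W y) y := by
  have hc : ContinuousOn (fun z => exp (-φ * z) * W z) (Ioi 0) :=
    (by fun_prop : Continuous fun z => exp (-φ * z)).continuousOn.mul hcont
  have h1 := intervalIntegral.integral_hasDerivAt_right (a := 0) (b := y) hint.intervalIntegrable
    (hc.stronglyMeasurableAtFilter isOpen_Ioi y hy) (hc.continuousAt (Ioi_mem_nhds hy))
  have h2 : HasDerivAt (fun y => exp (φ * y)) (exp (φ * y) * (φ * 1)) y :=
    ((hasDerivAt_id y).const_mul φ).exp
  refine (h2.mul h1).congr_deriv ?_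
  have e : exp (φ * y) * exp (-φ * y) = 1 := by rw [← Real.exp_add]; simp
  rw [expConv]
  linear_combination W y * e

theorem hasDerivAt_expConv₁ (hint : Integrable (fun z => exp (-φ * z) * W z)) (y : ℝ) :
    HasDerivAt (expConv₁ φ W) (φ * expConv φ W y) y :=
  ((continuous_expConv hint).integral_hasStrictDerivAt 0 y).hasDerivAt.const_mul φ

theorem hasDerivAt_expConv₂ (hint : Integrable (fun z => exp (-φ * z) * W z)) (y : ℝ) :
    HasDerivAt (expConv₂ φ W) (expConv₁ φ W y) y :=
  have hc : Continuous (expConv₁ φ W) :=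
    continuous_iff_continuousAt.2 fun y => (hasDerivAt_expConv₁ hint y).continuousAt
  (hc.integral_hasStrictDerivAt 0 y).hasDerivAt

theorem expConv₁_eq (hneg : ∀ x < 0, W x = 0)
    (hint : Integrable (fun z => exp (-φ * z) * W z)) (hcont : ContinuousOn W (Ioi 0)) (y : ℝ) :
    expConv₁ φ W y = expConv φ W y - Wbar W y := by
  rcases le_total y 0 with hy | hy
  · rw [expConv₁_of_nonpos hneg hy, expConv_of_nonpos hneg hy, Wbar,
      intervalIntegral_eq_zero_of_nonpos hneg hy, sub_zero]
  · have hE : IntervalIntegrable (fun z => φ * expConv φ W z) volume 0 y :=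
      ((continuous_expConv hint).const_mul φ).intervalIntegrable _ _
    have hW := intervalIntegrable_of_integrable_exp_mul hint 0 y
    have := intervalIntegral.integral_eq_sub_of_hasDerivAt_of_le hy
      (continuous_expConv hint).continuousOn
      (fun x hx => hasDerivAt_expConv hint hcont hx.1) (hE.add hW)
    rw [intervalIntegral.integral_add hE hW, intervalIntegral.integral_const_mul,
      expConv_of_nonpos hneg le_rfl] at this
    rw [expConv₁, Wbar]
    linarith

theorem expConv₂_eq (hφ : φ ≠ 0) (hneg : ∀ x < 0, W x = 0)
    (hint : Integrable (fun z => exp (-φ * z) * W z)) (hcont : ContinuousOn W (Ioi 0)) (y : ℝ) :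
    expConv₂ φ W y = expConv φ W y / φ - Wbar W y / φ - ∫ z in (0:ℝ)..y, Wbar W z := by
  have hc : Continuous (Wbar W) := intervalIntegral.continuous_primitive
    (intervalIntegrable_of_integrable_exp_mul hint) 0
  rw [← sub_div, ← expConv₁_eq hneg hint hcont, expConv₂, expConv₁, mul_div_cancel_left₀ _ hφ]
  simp_rw [expConv₁_eq hneg hint hcont]
  exact intervalIntegral.integral_sub ((continuous_expConv hint).intervalIntegrable _ _)
    (hc.intervalIntegrable _ _)

theorem expConv_nonneg (hneg : ∀ x < 0, W x = 0) (hnn : ∀ x, 0 ≤ W x) (y : ℝ) :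
    0 ≤ expConv φ W y := by
  rcases le_total y 0 with hy | hy
  · exact (expConv_of_nonpos hneg hy).ge
  · exact mul_nonneg (exp_pos _).le (intervalIntegral.integral_nonneg hy fun z _ =>
      mul_nonneg (exp_pos _).le (hnn z))

theorem expConv_le (hneg : ∀ x < 0, W x = 0) (hnn : ∀ x, 0 ≤ W x)
    (hint : Integrable (fun z => exp (-φ * z) * W z)) (y : ℝ) :
    expConv φ W y ≤ (∫ z, exp (-φ * z) * W z) * exp (φ * y) := by
  have h0 : ∀ z, 0 ≤ exp (-φ * z) * W z := fun z => mul_nonneg (exp_pos _).le (hnn z)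
  rcases le_total y 0 with hy | hy
  · rw [expConv_of_nonpos hneg hy]
    exact mul_nonneg (integral_nonneg h0) (exp_pos _).le
  · rw [expConv, mul_comm, intervalIntegral.integral_of_le hy]
    exact mul_le_mul_of_nonneg_right (setIntegral_le_integral hint (ae_of_all _ h0)) (exp_pos _).le

theorem expConv₁_nonneg (hφ : 0 < φ) (hneg : ∀ x < 0, W x = 0) (hnn : ∀ x, 0 ≤ W x) (y : ℝ) :
    0 ≤ expConv₁ φ W y := by
  rcases le_total y 0 with hy | hy
  · exact (expConv₁_of_nonpos hneg hy).ge
  · exact mul_nonneg hφ.le (intervalIntegral.integral_nonneg hy fun z _ =>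
      expConv_nonneg hneg hnn z)

theorem expConv₂_nonneg (hφ : 0 < φ) (hneg : ∀ x < 0, W x = 0) (hnn : ∀ x, 0 ≤ W x) (y : ℝ) :
    0 ≤ expConv₂ φ W y := by
  rcases le_total y 0 with hy | hy
  · exact (expConv₂_of_nonpos hneg hy).ge
  · exact intervalIntegral.integral_nonneg hy fun z _ => expConv₁_nonneg hφ hneg hnn z

theorem le_mul_exp_of_deriv_le {g g' : ℝ → ℝ} {K : ℝ} (hK : 0 ≤ K) (h0 : ∀ y ≤ 0, g y = 0)
    (hd : ∀ y, HasDerivAt g (g' y) y) (hle : ∀ y, g' y ≤ K * φ * exp (φ * y)) (y : ℝ) :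
    g y ≤ K * exp (φ * y) := by
  have hmono : Monotone fun y => K * exp (φ * y) - g y := by
    refine monotone_of_hasDerivAt_nonneg (f' := fun y => K * φ * exp (φ * y) - g' y)
      (fun y => ?_) fun y => sub_nonneg.2 (hle y)
    have h2 : HasDerivAt (fun y => exp (φ * y)) (exp (φ * y) * (φ * 1)) y :=
      ((hasDerivAt_id y).const_mul φ).exp
    exact ((h2.const_mul K).sub (hd y)).congr_deriv (by ring)
  rcases le_total y 0 with hy | hy
  · rw [h0 y hy]
    positivity
  · have := hmono hy
    simp only [h0 0 le_rfl, mul_zero, Real.exp_zero] at this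
    linarith

theorem expConv₁_le (hφ : 0 < φ) (hneg : ∀ x < 0, W x = 0) (hnn : ∀ x, 0 ≤ W x)
    (hint : Integrable (fun z => exp (-φ * z) * W z)) (y : ℝ) :
    expConv₁ φ W y ≤ (∫ z, exp (-φ * z) * W z) * exp (φ * y) :=
  le_mul_exp_of_deriv_le (integral_nonneg fun z => mul_nonneg (exp_pos _).le (hnn z))
    (fun _ hy => expConv₁_of_nonpos hneg hy) (hasDerivAt_expConv₁ hint)
    (fun y => (mul_le_mul_of_nonneg_left (expConv_le hneg hnn hint y) hφ.le).trans_eq (by ring)) y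

theorem expConv₂_le (hφ : 0 < φ) (hneg : ∀ x < 0, W x = 0) (hnn : ∀ x, 0 ≤ W x)
    (hint : Integrable (fun z => exp (-φ * z) * W z)) (y : ℝ) :
    expConv₂ φ W y ≤ (∫ z, exp (-φ * z) * W z) / φ * exp (φ * y) :=
  le_mul_exp_of_deriv_le
    (div_nonneg (integral_nonneg fun z => mul_nonneg (exp_pos _).le (hnn z)) hφ.le)
    (fun _ hy => expConv₂_of_nonpos hneg hy) (hasDerivAt_expConv₂ hint)
    (fun y => (expConv₁_le hφ hneg hnn hint y).trans_eq (by field_simp)) y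

theorem isExpConvex_expConv₂ (hφ : 0 < φ) (hneg : ∀ x < 0, W x = 0) (hnn : ∀ x, 0 ≤ W x)
    (hint : Integrable (fun z => exp (-φ * z) * W z)) :
    IsExpConvex ((∫ z, exp (-φ * z) * W z) / φ + φ * ∫ z, exp (-φ * z) * W z) φ
      (expConv₂ φ W) (expConv₁ φ W) (fun y => φ * expConv φ W y) where
  hasDerivAt := hasDerivAt_expConv₂ hint
  hasDerivAt' := hasDerivAt_expConv₁ hint
  nonneg := expConv₂_nonneg hφ hneg hnn
  nonneg' := expConv₁_nonneg hφ hneg hnn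
  nonneg'' y := mul_nonneg hφ.le (expConv_nonneg hneg hnn y)
  le y := by
    have hK : 0 ≤ ∫ z, exp (-φ * z) * W z :=
      integral_nonneg fun z => mul_nonneg (exp_pos _).le (hnn z)
    have : 0 ≤ φ * (∫ z, exp (-φ * z) * W z) * exp (φ * y) := by positivity
    linarith [expConv₂_le hφ hneg hnn hint y]
  le'' y := by
    have hK : 0 ≤ ∫ z, exp (-φ * z) * W z :=
      integral_nonneg fun z => mul_nonneg (exp_pos _).le (hnn z)
    have : 0 ≤ (∫ z, exp (-φ * z) * W z) / φ * exp (φ * y) := by positivity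
    linarith [mul_le_mul_of_nonneg_left (expConv_le hneg hnn hint y) hφ.le]
  rate_nonneg := hφ.le

end expConv

theorem isExpConvex_exp {φ : ℝ} (hφ : 0 < φ) :
    IsExpConvex (1 + φ ^ 2) φ (fun y => exp (φ * y)) (fun y => φ * exp (φ * y))
      (fun y => φ ^ 2 * exp (φ * y)) := by
  have hd : ∀ y, HasDerivAt (fun y => exp (φ * y)) (φ * exp (φ * y)) y := fun y =>
    (((hasDerivAt_id y).const_mul φ).exp).congr_deriv (by simp only [id]; ring)
  refine ⟨hd, fun y => ((hd y).const_mul φ).congr_deriv (by ring), fun y => by positivity,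
    fun y => by positivity, fun y => by positivity, fun y => ?_, fun y => ?_, hφ.le⟩
  · have : 0 ≤ φ ^ 2 * exp (φ * y) := by positivity
    linarith
  · linarith [exp_pos (φ * y)]

theorem levyIncr_exp (φ y z : ℝ) :
    levyIncr (fun y => exp (φ * y)) (fun y => φ * exp (φ * y)) y z =
      exp (φ * y) * (exp (-φ * z) - 1 + φ * Set.indicator (Set.Ioo (0:ℝ) 1) id z) := by
  have : exp (φ * (y - z)) = exp (φ * y) * exp (-φ * z) := by rw [← Real.exp_add]; ring_nf
  rw [levyIncr, this]; ring

theorem integrableOn_levyPsi {ν : Measure ℝ}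
    (hν : IntegrableOn (fun z => min 1 (z ^ 2)) (Ioi 0) ν) {φ : ℝ} (hφ : 0 < φ) :
    IntegrableOn (fun z => exp (-φ * z) - 1 + φ * Set.indicator (Set.Ioo (0:ℝ) 1) id z)
      (Ioi 0) ν := by
  have := (isExpConvex_exp hφ).integrableOn_levyIncr hν 0
  refine this.congr_fun (fun z _ => ?_) measurableSet_Ioi
  rw [levyIncr_exp, mul_zero, Real.exp_zero, one_mul]

/-- `ψ(θ) / θ` is nondecreasing. -/
theorem div_mul_levyPsi_le {γ σ : ℝ} {ν : Measure ℝ}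
    (hν : IntegrableOn (fun z => min 1 (z ^ 2)) (Ioi 0) ν) {φ θ : ℝ} (hφ : 0 < φ) (hθ : φ ≤ θ) :
    θ / φ * levyPsi γ σ ν φ ≤ levyPsi γ σ ν θ := by
  have h1 : 1 ≤ θ / φ := (one_le_div hφ).2 hθ
  have hint : θ / φ * ∫ z in Ioi (0:ℝ),
      (exp (-φ * z) - 1 + φ * Set.indicator (Set.Ioo (0:ℝ) 1) id z) ∂ν ≤ ∫ z in Ioi (0:ℝ),
      (exp (-θ * z) - 1 + θ * Set.indicator (Set.Ioo (0:ℝ) 1) id z) ∂ν := by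
    rw [← integral_const_mul]
    refine integral_mono ((integrableOn_levyPsi hν hφ).const_mul _)
      (integrableOn_levyPsi hν (hφ.trans_le hθ)) fun z => ?_
    have hb := one_add_mul_self_le_rpow_one_add (s := exp (-φ * z) - 1)
      (by linarith [exp_pos (-φ * z)]) h1
    rw [add_sub_cancel, ← Real.exp_mul] at hb
    have e : -φ * z * (θ / φ) = -θ * z := by field_simp
    rw [e] at hb
    have e2 : θ / φ * (φ * Set.indicator (Set.Ioo (0:ℝ) 1) id z) =
      θ * Set.indicator (Set.Ioo (0:ℝ) 1) id z := by field_simp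
    simp only [mul_add, e2]
    linarith
  have hs : θ / φ * (σ ^ 2 / 2 * φ ^ 2) ≤ σ ^ 2 / 2 * θ ^ 2 := by
    have e : θ / φ * (σ ^ 2 / 2 * φ ^ 2) = σ ^ 2 / 2 * (θ * φ) := by field_simp
    rw [e]
    have : θ * φ ≤ θ ^ 2 := by nlinarith
    gcongr
  have hg : θ / φ * (γ * φ) = γ * θ := by field_simp
  rw [levyPsi, levyPsi, mul_add, mul_add, hg]
  linarith

/-- The Laplace transform of `W * ((exp (φ ·) - 1 - φ ·) / φ)`. -/
theorem laplace_expConv₂ {φ θ : ℝ} {W : ℝ → ℝ} (hφ : 0 < φ) (hθ : φ < θ)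
    (hneg : ∀ x < 0, W x = 0) (hnn : ∀ x, 0 ≤ W x) (hcont : ContinuousOn W (Ioi 0))
    (hint : Integrable (fun z => exp (-φ * z) * W z))
    (hintθ : IntegrableOn (fun z => exp (-θ * z) * W z) (Ioi 0)) :
    θ ^ 2 * (θ - φ) * ∫ y in Ioi (0:ℝ), exp (-θ * y) * expConv₂ φ W y =
      φ * ∫ y in Ioi (0:ℝ), exp (-θ * y) * W y := by
  have h := isExpConvex_expConv₂ hφ hneg hnn hint
  have hE := continuous_expConv hint
  have hiE : IntegrableOn (fun y => exp (-θ * y) * expConv φ W y) (Ioi 0) :=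
    integrableOn_laplace_of_abs_le hE hθ fun y _ => by
      rw [abs_of_nonneg (expConv_nonneg hneg hnn y)]; exact expConv_le hneg hnn hint y
  have hiE₁ : IntegrableOn (fun y => exp (-θ * y) * expConv₁ φ W y) (Ioi 0) :=
    integrableOn_laplace_of_abs_le h.continuous' hθ fun y _ => by
      rw [abs_of_nonneg (h.nonneg' y)]; exact expConv₁_le hφ hneg hnn hint y
  have hiE₂ : IntegrableOn (fun y => exp (-θ * y) * expConv₂ φ W y) (Ioi 0) :=
    integrableOn_laplace_of_abs_le h.continuous hθ fun y _ => by
      rw [abs_of_nonneg (h.nonneg y)]; exact h.le y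
  have e₀ : ∀ y, exp (-θ * y) * (φ * expConv φ W y) = φ * (exp (-θ * y) * expConv φ W y) :=
    fun y => by ring
  have l₂ := laplace_deriv (expConv₂_of_nonpos hneg le_rfl) h.continuous.continuousWithinAt
    (fun y _ => h.hasDerivAt y) hiE₂ hiE₁
  have l₁ := laplace_deriv (expConv₁_of_nonpos hneg le_rfl) h.continuous'.continuousWithinAt
    (fun y _ => h.hasDerivAt' y) hiE₁ (by simp_rw [e₀]; exact hiE.const_mul φ)
  have l₀ := laplace_deriv (expConv_of_nonpos hneg le_rfl) hE.continuousWithinAt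
    (fun y hy => hasDerivAt_expConv hint hcont hy) hiE
    (by simp_rw [mul_add, e₀]; exact (hiE.const_mul φ).add hintθ)
  simp_rw [e₀] at l₁
  simp_rw [mul_add, e₀] at l₀
  rw [integral_add (hiE.const_mul φ) hintθ, integral_const_mul] at l₀
  rw [integral_const_mul] at l₁
  linear_combination (-(θ * (θ - φ))) * l₂ - (θ - φ) * l₁ - φ * l₀

/-- The Laplace transform of `(exp (φ ·) - 1 - φ ·) / φ`. -/
theorem laplace_exp_sub {φ θ : ℝ} (hφ : 0 < φ) (hθ : φ < θ) :
    IntegrableOn (fun y => exp (-θ * y) * ((exp (φ * y) - 1 - φ * y) / φ)) (Ioi 0) ∧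
    θ ^ 2 * (θ - φ) * ∫ y in Ioi (0:ℝ), exp (-θ * y) * ((exp (φ * y) - 1 - φ * y) / φ) = φ := by
  have hd : ∀ y, HasDerivAt (fun y => exp (φ * y)) (φ * exp (φ * y)) y :=
    (isExpConvex_exp hφ).hasDerivAt
  have hd₁ : ∀ y, HasDerivAt (fun y => exp (φ * y) - 1) (φ * exp (φ * y)) y :=
    fun y => (hd y).sub_const 1
  have hd₂ : ∀ y, HasDerivAt (fun y => (exp (φ * y) - 1 - φ * y) / φ) (exp (φ * y) - 1) y :=
    fun y => (((hd₁ y).sub ((hasDerivAt_id y).const_mul φ)).div_const φ).congr_deriv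
      (by field_simp)
  have hexp : ∀ y > 0, φ * y + 1 ≤ exp (φ * y) := fun y _ => add_one_le_exp _
  have hpos : ∀ y > 0, 0 < φ * y := fun y hy => by positivity
  have hi₂ : IntegrableOn (fun y => exp (-θ * y) * ((exp (φ * y) - 1 - φ * y) / φ)) (Ioi 0) :=
    integrableOn_laplace_of_abs_le (C := 1 / φ) (by fun_prop) hθ fun y hy => by
      have h1 := hexp y hy
      have h2 := hpos y hy
      rw [abs_of_nonneg (div_nonneg (by linarith) hφ.le), div_mul_eq_mul_div]
      gcongr
      linarith
  have hi₁ : IntegrableOn (fun y => exp (-θ * y) * (exp (φ * y) - 1)) (Ioi 0) :=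
    integrableOn_laplace_of_abs_le (C := 1) (by fun_prop) hθ fun y hy => by
      have h1 := hexp y hy
      have h2 := hpos y hy
      rw [abs_of_nonneg (by linarith)]
      linarith
  have hi₀ : IntegrableOn (fun y => exp (-θ * y) * (φ * exp (φ * y))) (Ioi 0) :=
    integrableOn_laplace_of_abs_le (C := φ) (by fun_prop) hθ fun y hy => by
      rw [abs_of_nonneg (by positivity)]
  have l₂ := laplace_deriv (by simp) (by fun_prop) (fun y _ => hd₂ y) hi₂ hi₁
  have l₁ := laplace_deriv (by simp) (by fun_prop) (fun y _ => hd₁ y) hi₁ hi₀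
  have e : ∀ y, exp (-θ * y) * (φ * exp (φ * y)) = φ * exp ((φ - θ) * y) := fun y => by
    rw [mul_left_comm, ← Real.exp_add]; ring_nf
  simp_rw [e] at l₁
  rw [integral_const_mul, integral_exp_mul_Ioi (by linarith), mul_zero, Real.exp_zero] at l₁
  have hne : φ - θ ≠ 0 := by linarith
  refine ⟨hi₂, ?_⟩
  have l₀ : (θ - φ) * (φ * (-1 / (φ - θ))) = φ := by field_simp; ring
  linear_combination (-(θ * (θ - φ))) * l₂ - (θ - φ) * l₁ + l₀

/-- The dual generator applied to `W * ((exp (φ ·) - 1 - φ ·) / φ)`. -/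
theorem generator_expConv₂ {γ σ q φ : ℝ} {ν : Measure ℝ} {W : ℝ → ℝ}
    (hν : IntegrableOn (fun z => min 1 (z ^ 2)) (Ioi 0) ν) (hφ : 0 < φ)
    (hψ : ∀ θ > φ, q < levyPsi γ σ ν θ)
    (hneg : ∀ x < 0, W x = 0) (hnn : ∀ x, 0 ≤ W x) (hcont : ContinuousOn W (Ioi 0))
    (hint : Integrable (fun z => exp (-φ * z) * W z))
    (hlap : ∀ θ > φ, IntegrableOn (fun z => exp (-θ * z) * W z) (Ioi 0) ∧
      ∫ z in Ioi (0:ℝ), exp (-θ * z) * W z = 1 / (levyPsi γ σ ν θ - q)) {y : ℝ} (hy : 0 < y) :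
    γ * expConv₁ φ W y + σ ^ 2 / 2 * (φ * expConv φ W y) +
      (∫ z in Ioi (0:ℝ), levyIncr (expConv₂ φ W) (expConv₁ φ W) y z ∂ν) - q * expConv₂ φ W y =
      (exp (φ * y) - 1 - φ * y) / φ := by
  have h := isExpConvex_expConv₂ hφ hneg hnn hint
  have hE := continuous_expConv hint
  have hJ := h.continuous_integral_levyIncr hν
  set J : ℝ → ℝ := fun y => 
    ∫ z in Ioi (0:ℝ), levyIncr (expConv₂ φ W) (expConv₁ φ W) y z ∂ν
  set k : ℝ → ℝ := fun y => (exp (φ * y) - 1 - φ * y) / φ with hk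
  have hkc : Continuous k := by fun_prop
  have hc : Continuous fun y => γ * expConv₁ φ W y + σ ^ 2 / 2 * (φ * expConv φ W y) + J y -
      q * expConv₂ φ W y - k y := by
    have h1 := h.continuous
    have h2 := h.continuous'
    fun_prop
  have key : ∀ θ > φ, IntegrableOn (fun y => exp (-θ * y) * (γ * expConv₁ φ W y +
        σ ^ 2 / 2 * (φ * expConv φ W y) + J y - q * expConv₂ φ W y - k y)) (Ioi 0) ∧
      ∫ y in Ioi (0:ℝ), exp (-θ * y) * (γ * expConv₁ φ W y +
        σ ^ 2 / 2 * (φ * expConv φ W y) + J y - q * expConv₂ φ W y - k y) = 0 := by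
    intro θ hθ
    have hiE : IntegrableOn (fun y => exp (-θ * y) * (φ * expConv φ W y)) (Ioi 0) :=
      integrableOn_laplace_of_abs_le (by fun_prop) hθ fun y _ => by
        rw [abs_of_nonneg (h.nonneg'' y)]; exact h.le'' y
    have hiE₁ : IntegrableOn (fun y => exp (-θ * y) * expConv₁ φ W y) (Ioi 0) :=
      integrableOn_laplace_of_abs_le h.continuous' hθ fun y _ => by
        rw [abs_of_nonneg (h.nonneg' y)]; exact expConv₁_le hφ hneg hnn hint y
    have hiE₂ : IntegrableOn (fun y => exp (-θ * y) * expConv₂ φ W y) (Ioi 0) :=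
      integrableOn_laplace_of_abs_le h.continuous hθ fun y _ => by
        rw [abs_of_nonneg (h.nonneg y)]; exact h.le y
    have l₂ := laplace_deriv (expConv₂_of_nonpos hneg le_rfl) h.continuous.continuousWithinAt
      (fun y _ => h.hasDerivAt y) hiE₂ hiE₁
    have l₁ := laplace_deriv (expConv₁_of_nonpos hneg le_rfl) h.continuous'.continuousWithinAt
      (fun y _ => h.hasDerivAt' y) hiE₁ hiE
    obtain ⟨hiJ, lJ⟩ := h.laplace_integral_levyIncr hν (fun y hy => expConv₂_of_nonpos hneg hy)
      hθ hiE₂ hiE₁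
    obtain ⟨hik, lk⟩ := laplace_exp_sub hφ hθ
    obtain ⟨hiW, lW⟩ := hlap θ hθ
    have lF := laplace_expConv₂ hφ hθ hneg hnn hcont hint hiW
    have e : (fun y => exp (-θ * y) * (γ * expConv₁ φ W y +
        σ ^ 2 / 2 * (φ * expConv φ W y) + J y - q * expConv₂ φ W y - k y)) = fun y =>
        γ * (exp (-θ * y) * expConv₁ φ W y) + σ ^ 2 / 2 * (exp (-θ * y) * (φ * expConv φ W y)) +
        exp (-θ * y) * J y - q * (exp (-θ * y) * expConv₂ φ W y) - exp (-θ * y) * k y := by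
      funext y; ring
    rw [e]
    have i₁ := hiE₁.const_mul γ
    have i₂ := i₁.add (hiE.const_mul (σ ^ 2 / 2))
    have i₃ := i₂.add hiJ
    have i₄ := i₃.sub (hiE₂.const_mul q)
    refine ⟨i₄.sub hik, ?_⟩
    have s₁ := integral_sub i₄ hik
    have s₂ := integral_sub i₃ (hiE₂.const_mul q)
    have s₃ := integral_add i₂ hiJ
    have s₄ := integral_add i₁ (hiE.const_mul (σ ^ 2 / 2))
    simp only [Pi.add_apply, Pi.sub_apply] at s₁ s₂ s₃ s₄
    rw [s₁, s₂, s₃, s₄, integral_const_mul, integral_const_mul, integral_const_mul, l₁, l₂, lJ]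
    have hψθ : levyPsi γ σ ν θ - q ≠ 0 := (sub_pos.2 (hψ θ hθ)).ne'
    rw [lW, mul_one_div, eq_div_iff hψθ, levyPsi] at lF
    have hne : θ ^ 2 * (θ - φ) ≠ 0 :=
      mul_ne_zero (pow_ne_zero 2 (hφ.trans hθ).ne') (sub_pos.2 hθ).ne'
    apply mul_left_cancel₀ hne
    linear_combination lF - lk
  have := eqOn_zero_of_laplace_eq_zero hc.continuousOn (fun θ hθ => (key θ hθ).1)
    (fun θ hθ => (key θ hθ).2) (mem_Ioi.2 hy)
  exact sub_eq_zero.1 this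

theorem integrableOn_sub_indicator {ν : Measure ℝ} (hν1 : IntegrableOn (fun z => z) (Ici 1) ν) :
    IntegrableOn (fun z => z - Set.indicator (Set.Ioo (0:ℝ) 1) id z) (Ioi 0) ν ∧
    ∫ z in Ioi (0:ℝ), (z - Set.indicator (Set.Ioo (0:ℝ) 1) id z) ∂ν = ∫ z in Ici (1:ℝ), z ∂ν := by
  have e : EqOn (fun z => z - Set.indicator (Set.Ioo (0:ℝ) 1) id z)
      (Set.indicator (Set.Ici (1:ℝ)) id) (Ioi 0) := by
    intro z hz
    have hz : 0 < z := hz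
    rcases lt_or_ge z 1 with h | h
    · have h1 : z ∈ Ioo (0:ℝ) 1 := ⟨hz, h⟩
      have h2 : z ∉ Ici (1:ℝ) := not_le.2 h
      simp only [indicator_of_mem h1, indicator_of_notMem h2, id, sub_self]
    · have h1 : z ∉ Ioo (0:ℝ) 1 := fun hm => not_lt.2 h hm.2
      have h2 : z ∈ Ici (1:ℝ) := h
      simp only [indicator_of_notMem h1, indicator_of_mem h2, id, sub_zero]
  have hsub : Ioi (0:ℝ) ∩ Ici 1 = Ici 1 := inter_eq_right.2 fun z hz =>
    mem_Ioi.2 (zero_lt_one.trans_le hz)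
  constructor
  · refine IntegrableOn.congr_fun ?_ e.symm measurableSet_Ioi
    exact ((integrable_indicator_iff measurableSet_Ici).2 hν1).integrableOn
  · rw [setIntegral_congr_fun measurableSet_Ioi e, setIntegral_indicator measurableSet_Ici, hsub]
    rfl

/-- The generator applied to a function reflected at `b`. -/
theorem levyGen_reflect {γ σ b : ℝ} {ν : Measure ℝ} {u u' u'' v : ℝ → ℝ}
    (hu : ∀ y, HasDerivAt u (u' y) y) (hu' : ∀ y, HasDerivAt u' (u'' y) y)
    (hv : ∀ x, v x = u (b - x)) (x : ℝ) :
    (∀ z, v (x + z) - v x - deriv v x * Set.indicator (Set.Ioo (0:ℝ) 1) id z =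
      levyIncr u u' (b - x) z) ∧
    levyGen γ σ ν v x = γ * u' (b - x) + σ ^ 2 / 2 * u'' (b - x) +
      ∫ z in Ioi (0:ℝ), levyIncr u u' (b - x) z ∂ν := by
  obtain rfl : v = fun x => u (b - x) := funext hv
  have hd : deriv (fun x => u (b - x)) = fun x => -u' (b - x) :=
    funext fun x => ((hu (b - x)).comp_const_sub b x).deriv
  have hd' : deriv (fun x => -u' (b - x)) x = u'' (b - x) :=
    (((hu' (b - x)).comp_const_sub b x).neg.deriv).trans (neg_neg _)
  have e : ∀ z, u (b - (x + z)) - u (b - x) -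
      deriv (fun x => u (b - x)) x * Set.indicator (Set.Ioo (0:ℝ) 1) id z =
        levyIncr u u' (b - x) z := fun z => by
    rw [hd, levyIncr, sub_sub b x z]; ring
  refine ⟨e, ?_⟩
  simp only [levyGen, e]
  rw [hd, hd']
  ring

/-- for the smooth-fit form v(x) = −(r/(r+q))(Zbar(b−x)+m/q) − Zqr(b−x)/φ with b > 0,
the generator integral converges absolutely and (ℒ − q)v(x) = 0 for x ∈ (0,b), while for x > b,
(ℒ − q)v(x) = (qr/(r+q))·[(b−x) + (1 − e^{φ(b−x)})/φ]. -/
theorem levyGen_value_function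
    (γ σ : ℝ) (hσ : 0 ≤ σ) (ν : MeasureTheory.Measure ℝ)
    (hν : MeasureTheory.IntegrableOn (fun z => min 1 (z ^ 2)) (Set.Ioi 0) ν)
    (hν1 : MeasureTheory.IntegrableOn (fun z => z) (Set.Ici 1) ν)
    (m : ℝ) (hm : m = γ - ∫ z in Set.Ici (1:ℝ), z ∂ν)
    (q r φ : ℝ) (hq : 0 < q) (hr : 0 < r) (hφ : 0 < φ)
    (hψφ : levyPsi γ σ ν φ = q + r)
    (W : ℝ → ℝ)
    (hWneg : ∀ x < (0:ℝ), W x = 0)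
    (hWnn : ∀ x : ℝ, 0 ≤ W x)
    (hWcont : ContinuousOn W (Set.Ioi 0))
    (hWmono : StrictMonoOn W (Set.Ioi 0))
    (hWrc : ∃ W0 : ℝ, Filter.Tendsto W (nhdsWithin 0 (Set.Ioi 0)) (nhds W0))
    (hWlap : ∀ θ : ℝ, 0 < θ → q < levyPsi γ σ ν θ →
      MeasureTheory.IntegrableOn (fun z => Real.exp (-θ * z) * W z) (Set.Ioi 0) ∧
      ∫ z in Set.Ioi (0:ℝ), Real.exp (-θ * z) * W z = 1 / (levyPsi γ σ ν θ - q))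
    (b : ℝ) (hb : 0 < b)
    (v : ℝ → ℝ)
    (hv : ∀ x : ℝ, v x = -(r / (r + q)) * (Zbar q W (b - x) + m / q) - Zqr q r φ W (b - x) / φ)
    : (∀ x : ℝ, x ∈ Set.Ioo 0 b →
        MeasureTheory.IntegrableOn
          (fun z => v (x + z) - v x - deriv v x * Set.indicator (Set.Ioo (0:ℝ) 1) id z)
          (Set.Ioi 0) ν ∧
        levyGen γ σ ν v x - q * v x = 0) ∧
      (∀ x : ℝ, b < x →
        MeasureTheory.IntegrableOn
          (fun z => v (x + z) - v x - deriv v x * Set.indicator (Set.Ioo (0:ℝ) 1) id z)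
          (Set.Ioi 0) ν ∧
        levyGen γ σ ν v x - q * v x =
          q * r / (r + q) * ((b - x) + (1 - Real.exp (φ * (b - x))) / φ)) := by
  have hne : r + q ≠ 0 := by positivity
  have hψ : ∀ θ > φ, q < levyPsi γ σ ν θ := fun θ hθ => by
    have h := div_mul_levyPsi_le (γ := γ) (σ := σ) hν hφ hθ.le
    rw [hψφ] at h
    have : 1 ≤ θ / φ := (one_le_div hφ).2 hθ.le
    nlinarith
  have hint : Integrable (fun z => exp (-φ * z) * W z) :=
    integrable_exp_mul_of_integrableOn hWneg (hWlap φ hφ (by linarith)).1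
  have hconv := isExpConvex_expConv₂ hφ hWneg hWnn hint
  have hexp := isExpConvex_exp hφ
  set c := q * r / (r + q) with hc
  set β := r / (r + q) with hβ
  set δ := q / (r + q) / φ with hδ
  set α := -β * (m / q) - β / φ with hα
  set u : ℝ → ℝ := fun y => α - β * y - δ * exp (φ * y) + c * expConv₂ φ W y with hu
  set u' : ℝ → ℝ := fun y => -β - δ * (φ * exp (φ * y)) + c * expConv₁ φ W y with hu'
  have hdu : ∀ y, HasDerivAt u (u' y) y := fun y =>
    (((((hasDerivAt_id y).const_mul β).const_sub α).sub ((hexp.hasDerivAt y).const_mul δ)).add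
      ((hconv.hasDerivAt y).const_mul c)).congr_deriv (by simp only [hu', mul_one])
  have hdu' : ∀ y, HasDerivAt u'
      (-(δ * (φ ^ 2 * exp (φ * y))) + c * (φ * expConv φ W y)) y := fun y =>
    (((hexp.hasDerivAt' y).const_mul δ).const_sub (-β)).add ((hconv.hasDerivAt' y).const_mul c)
  have hvu : ∀ x, v x = u (b - x) := fun x => by
    have hWi := intervalIntegrable_of_integrable_exp_mul hint
    have hZ : Zbar q W (b - x) = (b - x) + q * ∫ z in (0:ℝ)..(b - x), Wbar W z := by
      have hWc : Continuous (Wbar W) := intervalIntegral.continuous_primitive hWi 0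
      simp only [Zbar, Zq]
      rw [intervalIntegral.integral_add intervalIntegrable_const
        ((hWc.const_mul q).intervalIntegrable _ _), intervalIntegral.integral_const_mul]
      simp
    have hJ : Jfun r φ W (b - x) = exp (φ * (b - x)) - r * expConv φ W (b - x) := by
      rw [Jfun, expConv]; ring
    rw [hv, Zqr, Zq, hZ, hJ]
    simp only [hu, expConv₂_eq hφ.ne' hWneg hint hWcont, hα, hδ, hβ, hc]
    field_simp
    ring
  obtain ⟨hlin, hlin'⟩ := integrableOn_sub_indicator hν1
  have hincr : ∀ y z, levyIncr u u' y z =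
      β * (z - Set.indicator (Set.Ioo (0:ℝ) 1) id z) - δ * exp (φ * y) *
        (exp (-φ * z) - 1 + φ * Set.indicator (Set.Ioo (0:ℝ) 1) id z) +
        c * levyIncr (expConv₂ φ W) (expConv₁ φ W) y z := fun y z => by
    have : exp (φ * (y - z)) = exp (φ * y) * exp (-φ * z) := by rw [← Real.exp_add]; ring_nf
    simp only [levyIncr, hu, hu', this]
    ring
  have i₁ := hlin.const_mul β
  have i₂ := fun y => i₁.sub ((integrableOn_levyPsi hν hφ).const_mul (δ * exp (φ * y)))
  have i₃ := fun y => (hconv.integrableOn_levyIncr hν y).const_mul c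
  have hui : ∀ y, IntegrableOn (levyIncr u u' y) (Ioi 0) ν := fun y =>
    ((i₂ y).add (i₃ y)).congr (ae_of_all _ fun z => (hincr y z).symm)
  have hgen : ∀ x, levyGen γ σ ν v x - q * v x = -(c * ((exp (φ * (b - x)) - 1 - φ * (b - x)) / φ)) +
      c * (γ * expConv₁ φ W (b - x) + σ ^ 2 / 2 * (φ * expConv φ W (b - x)) +
        (∫ z in Ioi (0:ℝ), levyIncr (expConv₂ φ W) (expConv₁ φ W) (b - x) z ∂ν) -
        q * expConv₂ φ W (b - x)) := fun x => by
    have s₁ := integral_add (i₂ (b - x)) (i₃ (b - x))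
    have s₂ := integral_sub i₁ ((integrableOn_levyPsi hν hφ).const_mul (δ * exp (φ * (b - x))))
    simp only [Pi.sub_apply] at s₁
    rw [(levyGen_reflect hdu hdu' hvu x).2, hvu]
    simp only [hincr]
    rw [s₁, s₂, integral_const_mul, integral_const_mul, integral_const_mul, hlin']
    rw [levyPsi] at hψφ
    have hI : ∫ z in Ici (1:ℝ), z ∂ν = γ - m := by linarith
    rw [hI, eq_sub_of_add_eq' hψφ]
    simp only [hu, hu', hα, hδ, hβ, hc]
    field_simp
    ring
  have hvi : ∀ x, IntegrableOn
      (fun z => v (x + z) - v x - deriv v x * Set.indicator (Set.Ioo (0:ℝ) 1) id z) (Ioi 0) ν :=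
    fun x => by
      simp only [(levyGen_reflect (γ := γ) (σ := σ) (ν := ν) hdu hdu' hvu x).1]
      exact hui (b - x)
  refine ⟨fun x hx => ⟨hvi x, ?_⟩, fun x hx => ⟨hvi x, ?_⟩⟩
  · rw [hgen, generator_expConv₂ hν hφ hψ hWneg hWnn hWcont hint
      (fun θ hθ => hWlap θ (hφ.trans hθ) (hψ θ hθ)) (sub_pos.2 hx.2)]
    ring
  · have hy : b - x ≤ 0 := by linarith
    have hz : ∫ z in Ioi (0:ℝ), levyIncr (expConv₂ φ W) (expConv₁ φ W) (b - x) z ∂ν = 0 :=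
      setIntegral_eq_zero_of_forall_eq_zero fun z hz => by
        rw [levyIncr, expConv₂_of_nonpos hWneg hy, expConv₁_of_nonpos hWneg hy,
          expConv₂_of_nonpos hWneg (by linarith [mem_Ioi.1 hz])]
        ring
    rw [hgen, hz, expConv₂_of_nonpos hWneg hy, expConv₁_of_nonpos hWneg hy,
      expConv_of_nonpos hWneg hy]
    field_simp
    ring
end
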